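/- arXiv:1908.04035 — 10 statements merged into one kernel-verified Lean document; each statement's English description precedes it below -/
import Mathlib

section
/- Let ρ be a 2×2 complex density matrix and let σ(ρ) be the 4×4 matrix, indexed by Fin 2 × Fin 2, whose ((j,j),(k,k)) entry is ρ_{jk} and all other entries 0. Let T be the 3×3 real matrix with entries t_{nm} = Re Tr(σ(ρ)·(σ_n ⊗ σ_m)) for n,m ∈ {1,2,3}, where ⊗ is the Kronecker product. Then TᵗT is the diagonal matrix diag(4|ρ_{01}|², 4|ρ_{01}|², 1); in particular, since 4|ρ_{01}|² ≤ 1, the sum of the two largest eigenvalues of TᵗT equals 1 + 4|ρ_{01}|². -/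
open Matrix Kronecker ComplexOrder

/-- The Pauli matrices `σ₁, σ₂, σ₃`. -/
noncomputable def pauli : Fin 3 → Matrix (Fin 2) (Fin 2) ℂ :=
  ![!![0, 1; 1, 0], !![0, -Complex.I; Complex.I, 0], !![1, 0; 0, -1]]

/-- The 4×4 matrix `σ(ρ) = Σ_{jk} ρ_{jk} |jj⟩⟨kk|`. -/
noncomputable def sigmaOf (ρ : Matrix (Fin 2) (Fin 2) ℂ) :
    Matrix (Fin 2 × Fin 2) (Fin 2 × Fin 2) ℂ :=
  fun p q => if p.1 = p.2 ∧ q.1 = q.2 then ρ p.1 q.1 else 0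

/-- The correlation matrix `T` with `t_{nm} = Re Tr(σ(ρ) (σ_n ⊗ σ_m))`. -/
noncomputable def corrT (ρ : Matrix (Fin 2) (Fin 2) ℂ) : Matrix (Fin 3) (Fin 3) ℝ :=
  fun n m => (Matrix.trace (sigmaOf ρ * (pauli n ⊗ₖ pauli m))).re

theorem stmt1 (ρ : Matrix (Fin 2) (Fin 2) ℂ) (hρ : ρ.PosSemidef) (htr : ρ.trace = 1) :
    (corrT ρ)ᵀ * corrT ρ =
      Matrix.diagonal ![4 * ‖ρ 0 1‖ ^ 2, 4 * ‖ρ 0 1‖ ^ 2, 1] ∧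
    4 * ‖ρ 0 1‖ ^ 2 ≤ 1 ∧
    ∀ hM : ((corrT ρ)ᵀ * corrT ρ).IsHermitian,
      ∃ i : Fin 3, (∀ j : Fin 3, hM.eigenvalues i ≤ hM.eigenvalues j) ∧
        (∑ j : Fin 3, hM.eigenvalues j) - hM.eigenvalues i =
          1 + 4 * ‖ρ 0 1‖ ^ 2 := by
  have h10 : ρ 1 0 = star (ρ 0 1) := (hρ.1.apply 1 0).symm
  have h10r : (ρ 1 0).re = (ρ 0 1).re := by rw [h10]; simp
  have h10i : (ρ 1 0).im = -(ρ 0 1).im := by rw [h10]; simp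
  have hn : ‖ρ 0 1‖ ^ 2 = (ρ 0 1).re ^ 2 + (ρ 0 1).im ^ 2 := by
    rw [← Complex.normSq_eq_norm_sq, Complex.normSq_apply]; ring
  have htr' : (ρ 0 0).re + (ρ 1 1).re = 1 := by
    have := congrArg Complex.re htr
    simpa [Matrix.trace, Fin.sum_univ_two] using this
  have hdiag : (corrT ρ)ᵀ * corrT ρ =
      Matrix.diagonal ![4 * ‖ρ 0 1‖ ^ 2, 4 * ‖ρ 0 1‖ ^ 2, 1] := by
    have hT : corrT ρ = !![2 * (ρ 0 1).re, -2 * (ρ 0 1).im, 0;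
        -2 * (ρ 0 1).im, -2 * (ρ 0 1).re, 0; 0, 0, 1] := by
      ext n m
      fin_cases n <;> fin_cases m <;>
        simp [corrT, sigmaOf, pauli, Matrix.trace, Matrix.mul_apply, Fintype.sum_prod_type,
          Fin.sum_univ_two, Matrix.kroneckerMap_apply, h10r, h10i] <;> linarith
    rw [hT, hn]
    ext n m
    fin_cases n <;> fin_cases m <;>
      simp [Matrix.mul_apply, Fin.sum_univ_three, Matrix.diagonal] <;> ring
  have hle : 4 * ‖ρ 0 1‖ ^ 2 ≤ 1 := by
    have hd := (Complex.le_def.1 hρ.det_nonneg).1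
    have h0 : (ρ 0 0).im = 0 := by
      have := congrArg Complex.im (hρ.1.apply 0 0)
      simp at this; linarith
    rw [Matrix.det_fin_two] at hd
    simp [h10r, h10i, h0] at hd
    rw [hn]
    nlinarith [sq_nonneg ((ρ 0 0).re - (ρ 1 1).re), sq_nonneg ((ρ 0 0).re + (ρ 1 1).re)]
  refine ⟨hdiag, hle, fun hM => ?_⟩
  have hroots := hM.roots_charpoly_eq_eigenvalues
  have hsum := hM.trace_eq_sum_eigenvalues
  generalize hev : hM.eigenvalues = ev at *
  rw [hdiag] at hroots hsum
  generalize 4 * ‖ρ 0 1‖ ^ 2 = a at *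
  have hs : ∑ j, ev j = 2 * a + 1 := by
    simp [Matrix.trace, Fin.sum_univ_three] at hsum
    rw [Fin.sum_univ_three]; linarith
  rw [Matrix.charpoly_diagonal] at hroots
  have hmem : ∀ x, (∃ i, ev i = x) ↔ (x = a ∨ x = 1) := by
    intro x
    have h1 : x ∈ (∏ i, (Polynomial.X - Polynomial.C (![a, a, 1] i))).roots ↔
        (x = a ∨ x = 1) := by
      rw [Polynomial.mem_roots (Polynomial.monic_prod_X_sub_C _ _).ne_zero]
      simp [Fin.prod_univ_three, sub_eq_zero]
    rw [← h1, hroots]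
    simp [Fin.exists_fin_succ, eq_comm]
  obtain ⟨i, -, hi⟩ := Finset.exists_min_image Finset.univ ev ⟨0, Finset.mem_univ _⟩
  refine ⟨i, fun j => hi j (Finset.mem_univ _), ?_⟩
  obtain ⟨j, hj⟩ := (hmem a).2 (Or.inl rfl)
  have h1 := hi j (Finset.mem_univ _)
  have : ev i = a := by
    rcases (hmem (ev i)).1 ⟨i, rfl⟩ with h | h
    · exact h
    · linarith
  linarith
end

section
/- Let ρ be a 2×2 complex density matrix with ρ_{01} ≠ 0, and let σ(ρ) be the 4×4 matrix, indexed by Fin 2 × Fin 2, whose ((j,j),(k,k)) entry is ρ_{jk} and all other entries 0. Then there exist unit vectors a₁, a₂, b₁, b₂ ∈ ℝ³ such that |Tr(σ(ρ) · B)| > 2, where B = (a₁·σ)⊗(b₁·σ) + (a₁·σ)⊗(b₂·σ) + (a₂·σ)⊗(b₁·σ) − (a₂·σ)⊗(b₂·σ) is the CHSH operator. -/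
open Matrix Kronecker ComplexOrder

/-- For `a ∈ ℝ³`, the matrix `a·σ = a₁σ₁ + a₂σ₂ + a₃σ₃`. -/
noncomputable def dotPauli (a : Fin 3 → ℝ) : Matrix (Fin 2) (Fin 2) ℂ :=
  (a 0 : ℂ) • pauli 0 + (a 1 : ℂ) • pauli 1 + (a 2 : ℂ) • pauli 2

/-- The CHSH operator built from unit vectors `a₁, a₂, b₁, b₂ ∈ ℝ³`. -/
noncomputable def chshOp (a₁ a₂ b₁ b₂ : Fin 3 → ℝ) :
    Matrix (Fin 2 × Fin 2) (Fin 2 × Fin 2) ℂ :=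
  dotPauli a₁ ⊗ₖ dotPauli b₁ + dotPauli a₁ ⊗ₖ dotPauli b₂ +
    dotPauli a₂ ⊗ₖ dotPauli b₁ - dotPauli a₂ ⊗ₖ dotPauli b₂

theorem stmt2 (ρ : Matrix (Fin 2) (Fin 2) ℂ) (hρ : ρ.PosSemidef) (htr : ρ.trace = 1)
    (hcoh : ρ 0 1 ≠ 0) :
    ∃ a₁ a₂ b₁ b₂ : Fin 3 → ℝ,
      a₁ 0 ^ 2 + a₁ 1 ^ 2 + a₁ 2 ^ 2 = 1 ∧
      a₂ 0 ^ 2 + a₂ 1 ^ 2 + a₂ 2 ^ 2 = 1 ∧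
      b₁ 0 ^ 2 + b₁ 1 ^ 2 + b₁ 2 ^ 2 = 1 ∧
      b₂ 0 ^ 2 + b₂ 1 ^ 2 + b₂ 2 ^ 2 = 1 ∧
      2 < ‖Matrix.trace (sigmaOf ρ * chshOp a₁ a₂ b₁ b₂)‖ := by
  have h10 : ρ 1 0 = star (ρ 0 1) := (hρ.isHermitian.apply 1 0).symm
  have htr' : ρ 0 0 + ρ 1 1 = 1 := by simpa [Matrix.trace, Fin.sum_univ_two] using htr
  obtain ⟨x, y, hxy⟩ : ∃ x y : ℝ, ρ 0 1 = x + y * Complex.I :=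
    ⟨(ρ 0 1).re, (ρ 0 1).im, (Complex.re_add_im _).symm⟩
  have h10' : ρ 1 0 = x - y * Complex.I := by
    rw [h10, hxy]; simp [sub_eq_add_neg]
  have hpos : 0 < x ^ 2 + y ^ 2 := by
    by_contra hn
    have hx : x = 0 := by nlinarith [sq_nonneg x, sq_nonneg y]
    have hy : y = 0 := by nlinarith [sq_nonneg x, sq_nonneg y]
    apply hcoh
    rw [hxy, hx, hy]; simp
  obtain ⟨w, hw1, hw⟩ : ∃ w : ℝ, 1 < w ∧ w ^ 2 = 1 + 4 * (x ^ 2 + y ^ 2) := by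
    refine ⟨Real.sqrt (1 + 4 * (x ^ 2 + y ^ 2)), ?_, Real.sq_sqrt (by positivity)⟩
    rw [Real.lt_sqrt (by norm_num)]
    linarith
  have hw0 : w ≠ 0 := by positivity
  have hwc : (w : ℂ) ≠ 0 := by exact_mod_cast hw0
  have hwC : (w : ℂ) ^ 2 = 1 + 4 * ((x : ℂ) ^ 2 + (y : ℂ) ^ 2) := by exact_mod_cast hw
  refine ⟨![0, 0, 1], ![1, 0, 0], ![2 * x / w, -(2 * y / w), 1 / w],
    ![-(2 * x / w), 2 * y / w, 1 / w], by simp, by simp, ?_, ?_, ?_⟩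
  · simp
    field_simp
    linarith
  · simp
    field_simp
    linarith
  have key : Matrix.trace (sigmaOf ρ * chshOp ![0, 0, 1] ![1, 0, 0]
      ![2 * x / w, -(2 * y / w), 1 / w] ![-(2 * x / w), 2 * y / w, 1 / w])
      = ((2 * w : ℝ) : ℂ) := by
    have h00 : ρ 0 0 = 1 - ρ 1 1 := by linear_combination htr'
    simp [Matrix.trace, Matrix.mul_apply, Fintype.sum_prod_type, Fin.sum_univ_two, sigmaOf,
      chshOp, dotPauli, pauli, Matrix.kroneckerMap_apply, h10', hxy, h00]
    field_simp
    ring_nf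
    simp only [Complex.I_sq]
    linear_combination (-2) * hwC
  rw [key, Complex.norm_real, Real.norm_eq_abs, abs_of_pos (by linarith)]
  linarith
end

section
/- Let ρ be a 2×2 complex density matrix with ρ_{01} = 0, and let σ(ρ) be the 4×4 matrix, indexed by Fin 2 × Fin 2, whose ((j,j),(k,k)) entry is ρ_{jk} and all other entries 0. Then for all unit vectors a₁, a₂, b₁, b₂ ∈ ℝ³, |Tr(σ(ρ) · B)| ≤ 2, where B = (a₁·σ)⊗(b₁·σ) + (a₁·σ)⊗(b₂·σ) + (a₂·σ)⊗(b₁·σ) − (a₂·σ)⊗(b₂·σ) is the CHSH operator. -/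
open Matrix Kronecker ComplexOrder

theorem stmt3 (ρ : Matrix (Fin 2) (Fin 2) ℂ) (hρ : ρ.PosSemidef) (htr : ρ.trace = 1)
    (hcoh : ρ 0 1 = 0) :
    ∀ a₁ a₂ b₁ b₂ : Fin 3 → ℝ,
      a₁ 0 ^ 2 + a₁ 1 ^ 2 + a₁ 2 ^ 2 = 1 →
      a₂ 0 ^ 2 + a₂ 1 ^ 2 + a₂ 2 ^ 2 = 1 →
      b₁ 0 ^ 2 + b₁ 1 ^ 2 + b₁ 2 ^ 2 = 1 →
      b₂ 0 ^ 2 + b₂ 1 ^ 2 + b₂ 2 ^ 2 = 1 →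
      ‖Matrix.trace (sigmaOf ρ * chshOp a₁ a₂ b₁ b₂)‖ ≤ 2 := by
  intro a₁ a₂ b₁ b₂ h1 h2 h3 h4
  have h10 : ρ 1 0 = 0 := by
    have h := hρ.1.apply 1 0
    rw [hcoh, star_zero] at h
    exact h.symm
  have ht : ρ 0 0 + ρ 1 1 = 1 := by
    simpa [Matrix.trace, Fin.sum_univ_two] using htr
  have key : Matrix.trace (sigmaOf ρ * chshOp a₁ a₂ b₁ b₂)
      = ((a₁ 2 * (b₁ 2 + b₂ 2) + a₂ 2 * (b₁ 2 - b₂ 2) : ℝ) : ℂ) := by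
    have e : Matrix.trace (sigmaOf ρ * chshOp a₁ a₂ b₁ b₂)
      = (ρ 0 0 + ρ 1 1) * ((a₁ 2 * (b₁ 2 + b₂ 2) + a₂ 2 * (b₁ 2 - b₂ 2) : ℝ) : ℂ) := by
      simp [Matrix.trace, Matrix.mul_apply, Fintype.sum_prod_type, Fin.sum_univ_two, sigmaOf,
        chshOp, dotPauli, pauli, hcoh, h10, Matrix.kroneckerMap_apply]
      ring
    rw [e, ht, one_mul]
  rw [key, Complex.norm_real, Real.norm_eq_abs]
  have bd : ∀ v : Fin 3 → ℝ, v 0 ^ 2 + v 1 ^ 2 + v 2 ^ 2 = 1 → |v 2| ≤ 1 := by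
    intro v hv
    rw [← sq_le_one_iff_abs_le_one]
    nlinarith [sq_nonneg (v 0), sq_nonneg (v 1)]
  have A1 := bd _ h1
  have A2 := bd _ h2
  have B1 := abs_le.1 (bd _ h3)
  have B2 := abs_le.1 (bd _ h4)
  have s1 : |a₁ 2 * (b₁ 2 + b₂ 2)| ≤ |b₁ 2 + b₂ 2| := by
    rw [abs_mul]; exact mul_le_of_le_one_left (abs_nonneg _) A1
  have s2 : |a₂ 2 * (b₁ 2 - b₂ 2)| ≤ |b₁ 2 - b₂ 2| := by
    rw [abs_mul]; exact mul_le_of_le_one_left (abs_nonneg _) A2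
  have s3 : |b₁ 2 + b₂ 2| + |b₁ 2 - b₂ 2| ≤ 2 := by
    rcases abs_cases (b₁ 2 + b₂ 2) with h | h <;> rcases abs_cases (b₁ 2 - b₂ 2) with h' | h' <;>
      linarith [B1.1, B1.2, B2.1, B2.2]
  linarith [abs_add_le (a₁ 2 * (b₁ 2 + b₂ 2)) (a₂ 2 * (b₁ 2 - b₂ 2))]
end

section
/- Let d ≥ 2 and let ρ be a d×d complex density matrix. Let σ(ρ) be the d²×d² matrix, indexed by Fin d × Fin d, whose ((j,j),(k,k)) entry is ρ_{jk} and all other entries 0. Suppose there exist i ≠ j in Fin d with |ρ_{ij}| > √(1 − (ρ_{ii} + ρ_{jj})²)/2. Then there exist Hermitian d×d complex matrices A₁, A₂, B₁, B₂, each satisfying that I − A² is positive semidefinite (i.e. each has operator norm at most 1), such that |Tr(σ(ρ) · (A₁⊗B₁ + A₁⊗B₂ + A₂⊗B₁ − A₂⊗B₂))| > 2, where ⊗ denotes the Kronecker product. -/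
open Matrix Kronecker ComplexOrder

/-- The d²×d² matrix `σ(ρ) = Σ_{jk} ρ_{jk} |jj⟩⟨kk|`. -/
noncomputable def sigmaOfd (d : ℕ) (ρ : Matrix (Fin d) (Fin d) ℂ) :
    Matrix (Fin d × Fin d) (Fin d × Fin d) ℂ :=
  fun p q => if p.1 = p.2 ∧ q.1 = q.2 then ρ p.1 q.1 else 0

noncomputable def obsM {d : ℕ} (i j : Fin d) (a : ℝ) (z : ℂ) : Matrix (Fin d) (Fin d) ℂ :=
  fun p q => if p = i then (if q = i then (a : ℂ) else if q = j then z else 0)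
    else if p = j then (if q = i then star z else if q = j then -(a : ℂ) else 0) else 0

theorem sum_two {d : ℕ} {i j : Fin d} (hij : i ≠ j) (f : Fin d → ℂ)
    (h : ∀ c, c ≠ i → c ≠ j → f c = 0) : ∑ c, f c = f i + f j := by
  apply Finset.sum_eq_add i j hij
  · intro c _ hc
    exact h c hc.1 hc.2
  · simp
  · simp

theorem obsM_herm {d : ℕ} {i j : Fin d} (hij : i ≠ j) (a : ℝ) (z : ℂ) :
    (obsM i j a z).IsHermitian := by
  ext p q
  simp only [Matrix.conjTranspose_apply, obsM]
  have := hij.symm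
  split_ifs <;> simp_all

theorem obsM_psd {d : ℕ} {i j : Fin d} (hij : i ≠ j) (a : ℝ) (z : ℂ)
    (h : (a : ℂ) * a + z * star z = 1) :
    (1 - obsM i j a z * obsM i j a z).PosSemidef := by
  have : 1 - obsM i j a z * obsM i j a z
      = Matrix.diagonal (fun p => if p = i ∨ p = j then (0 : ℂ) else 1) := by
    ext p q
    rw [Matrix.sub_apply, Matrix.mul_apply, sum_two hij]
    · have h2 := hij.symm
      have h3 : star z * z + (a : ℂ) * a = 1 := by rw [← h]; ring
      by_cases p1 : p = i
      · subst p1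
        by_cases q1 : q = p
        · subst q1; simp [obsM, h2] ; simp at h; rw [h]; simp
        · by_cases q2 : q = j
          · subst q2; simp [obsM, hij, h2]; ring
          · simp [obsM, q1, q2, h2, Ne.symm q1, Matrix.one_apply]
      · by_cases p2 : p = j
        · subst p2
          by_cases q1 : q = i
          · subst q1; simp [obsM, h2]; ring
          · by_cases q2 : q = p
            · subst q2; simp [obsM, h2]; simp at h3; rw [h3]; simp
            · simp [obsM, q1, q2, h2, Ne.symm q2, Matrix.one_apply]
        · simp [obsM, p1, p2, Matrix.one_apply, Matrix.diagonal_apply]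
    · intro c h1 h2
      simp [obsM, h1, h2]
  rw [this]
  apply Matrix.PosSemidef.diagonal
  intro p
  simp only [Pi.zero_apply]
  split_ifs <;> simp

theorem trace_obs {d : ℕ} (ρ : Matrix (Fin d) (Fin d) ℂ) {i j : Fin d} (hij : i ≠ j)
    (a b : ℝ) (z w : ℂ) :
    Matrix.trace (sigmaOfd d ρ * (obsM i j a z ⊗ₖ obsM i j b w))
      = (a : ℂ) * b * (ρ i i + ρ j j) + ρ i j * (star z * star w) + ρ j i * (z * w) := by
  have h2 := hij.symm
  have key : Matrix.trace (sigmaOfd d ρ * (obsM i j a z ⊗ₖ obsM i j b w))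
      = ∑ p, ∑ q, ρ p q * (obsM i j a z q p * obsM i j b w q p) := by
    simp only [Matrix.trace, Matrix.diag_apply, Matrix.mul_apply, Fintype.sum_prod_type,
      sigmaOfd, Matrix.kroneckerMap_apply, ite_and, ite_mul, zero_mul]
    simp
  rw [key, sum_two hij, sum_two hij, sum_two hij]
  · simp [obsM, h2]; ring
  · intro c h1 h2; simp [obsM, h1, h2]
  · intro c h1 h2; simp [obsM, h1, h2]
  · intro c h1 h2
    apply Finset.sum_eq_zero
    intro q _
    simp [obsM, h1, h2]

theorem stmt5 (d : ℕ) (hd : 2 ≤ d) (ρ : Matrix (Fin d) (Fin d) ℂ)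
    (hρ : ρ.PosSemidef) (htr : ρ.trace = 1)
    (i j : Fin d) (hij : i ≠ j)
    (hgt : Real.sqrt (1 - ((ρ i i).re + (ρ j j).re) ^ 2) / 2 < ‖ρ i j‖) :
    ∃ A₁ A₂ B₁ B₂ : Matrix (Fin d) (Fin d) ℂ,
      A₁.IsHermitian ∧ A₂.IsHermitian ∧ B₁.IsHermitian ∧ B₂.IsHermitian ∧
      (1 - A₁ * A₁).PosSemidef ∧ (1 - A₂ * A₂).PosSemidef ∧
      (1 - B₁ * B₁).PosSemidef ∧ (1 - B₂ * B₂).PosSemidef ∧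
      2 < ‖Matrix.trace (sigmaOfd d ρ *
        (A₁ ⊗ₖ B₁ + A₁ ⊗ₖ B₂ + A₂ ⊗ₖ B₁ - A₂ ⊗ₖ B₂))‖ := by
  set r : ℝ := ‖ρ i j‖ with hr
  set s : ℝ := (ρ i i).re + (ρ j j).re with hs
  have hr0 : 0 < r := lt_of_le_of_lt (by positivity) hgt
  have hgt2 : 1 < s ^ 2 + 4 * r ^ 2 := by
    have h1 : Real.sqrt (1 - s ^ 2) < 2 * r := by linarith
    have h2 := (Real.sqrt_lt' (by linarith)).1 h1
    nlinarith
  set N : ℝ := Real.sqrt (s ^ 2 + 4 * r ^ 2) with hN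
  have hNN : N ^ 2 = s ^ 2 + 4 * r ^ 2 := Real.sq_sqrt (by positivity)
  have hN1 : 1 < N := by
    rw [hN]; exact Real.lt_sqrt_of_sq_lt (by linarith)
  have hN0 : N ≠ 0 := by linarith
  have hdiag : ∀ k, ρ k k = ((ρ k k).re : ℂ) := by
    intro k
    have := hρ.1.apply k k
    exact (Complex.conj_eq_iff_re.1 this).symm
  have hsum : ρ i i + ρ j j = (s : ℂ) := by
    rw [hdiag i, hdiag j, hs]; push_cast; rfl
  have hji : ρ j i = star (ρ i j) := (hρ.1.apply j i).symm
  have hrC : (r : ℂ) ≠ 0 := by exact_mod_cast hr0.ne'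
  have hNC : (N : ℂ) ≠ 0 := by exact_mod_cast hN0
  have hrr : ρ i j * star (ρ i j) = (r : ℂ) ^ 2 := by
    rw [hr]; exact Complex.mul_conj' _
  have hNNC : (N : ℂ) ^ 2 = s ^ 2 + 4 * r ^ 2 := by exact_mod_cast hNN
  have su : star (ρ i j / (r : ℂ)) = star (ρ i j) / r := by
    simp
  have sv : star ((2 * r / N : ℝ) : ℂ) = ((2 * r / N : ℝ) : ℂ) := Complex.conj_ofReal _
  have sv' : star (-((2 * r / N : ℝ) : ℂ)) = -((2 * r / N : ℝ) : ℂ) := by rw [star_neg, sv]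
  have hB : ((s / N : ℝ) : ℂ) * ((s / N : ℝ) : ℂ)
      + ((2 * r / N : ℝ) : ℂ) * ((2 * r / N : ℝ) : ℂ) = 1 := by
    push_cast
    field_simp
    rw [hNNC]; ring
  refine ⟨obsM i j 1 0, obsM i j 0 (ρ i j / r), obsM i j (s / N) ((2 * r / N : ℝ) : ℂ),
    obsM i j (s / N) (-((2 * r / N : ℝ) : ℂ)), obsM_herm hij _ _, obsM_herm hij _ _,
    obsM_herm hij _ _, obsM_herm hij _ _, obsM_psd hij _ _ ?_, obsM_psd hij _ _ ?_,
    obsM_psd hij _ _ ?_, obsM_psd hij _ _ ?_, ?_⟩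
  · simp
  · rw [su, div_mul_div_comm, hrr]
    push_cast
    field_simp
    simp
  · rw [sv]; exact hB
  · rw [sv', neg_mul_neg]; exact hB
  · have : Matrix.trace (sigmaOfd d ρ * (obsM i j 1 0 ⊗ₖ obsM i j (s / N) ((2 * r / N : ℝ) : ℂ)
        + obsM i j 1 0 ⊗ₖ obsM i j (s / N) (-((2 * r / N : ℝ) : ℂ))
        + obsM i j 0 (ρ i j / r) ⊗ₖ obsM i j (s / N) ((2 * r / N : ℝ) : ℂ)
        - obsM i j 0 (ρ i j / r) ⊗ₖ obsM i j (s / N) (-((2 * r / N : ℝ) : ℂ))))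
        = ((2 * N : ℝ) : ℂ) := by
      rw [Matrix.mul_sub, Matrix.mul_add, Matrix.mul_add, Matrix.trace_sub, Matrix.trace_add,
        Matrix.trace_add, trace_obs ρ hij, trace_obs ρ hij, trace_obs ρ hij, trace_obs ρ hij,
        hsum, hji, sv, sv', su, star_zero]
      have e1 : ∀ t : ℂ, ρ i j * (star (ρ i j) / r * t) = r * t := by
        intro t
        rw [show ρ i j * (star (ρ i j) / r * t) = (ρ i j * star (ρ i j)) / r * t by ring, hrr]
        field_simp
      have e2 : ∀ t : ℂ, star (ρ i j) * (ρ i j / r * t) = r * t := by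
        intro t
        rw [← e1]; ring
      simp only [e1, e2]
      push_cast
      field_simp
      rw [hNNC]; ring
    rw [this, Complex.norm_real, Real.norm_eq_abs, abs_of_pos (by linarith)]
    linarith
end

section
/- Let ρ be a 2×2 complex density matrix with |ρ_{01}| = 1/2. Then ρ_{00} = ρ_{11} = 1/2, and the 8×8 matrix τ(ρ), indexed by Fin 2 × Fin 2 × Fin 2, whose ((i,i,i),(j,j,j)) entry is ρ_{ij} and all other entries 0, is the rank-one projector |g⟩⟨g| onto the GHZ-type unit vector g = (e_{(0,0,0)} + 2·conj(ρ_{01})·e_{(1,1,1)})/√2. -/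
open Matrix ComplexOrder

/-- The 8×8 matrix `τ(ρ) = Σ_{ij} ρ_{ij} |iii⟩⟨jjj|`. -/
noncomputable def tauOf (ρ : Matrix (Fin 2) (Fin 2) ℂ) :
    Matrix (Fin 2 × Fin 2 × Fin 2) (Fin 2 × Fin 2 × Fin 2) ℂ :=
  fun p q => if p.1 = p.2.1 ∧ p.2.1 = p.2.2 ∧ q.1 = q.2.1 ∧ q.2.1 = q.2.2
    then ρ p.1 q.1 else 0

theorem stmt10 (ρ : Matrix (Fin 2) (Fin 2) ℂ) (hρ : ρ.PosSemidef) (htr : ρ.trace = 1)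
    (hcoh : ‖ρ 0 1‖ = 1 / 2) :
    let g : Fin 2 × Fin 2 × Fin 2 → ℂ := fun m =>
      if m = (0, 0, 0) then (1 / Real.sqrt 2 : ℝ)
      else if m = (1, 1, 1) then 2 * (starRingEnd ℂ) (ρ 0 1) / (Real.sqrt 2 : ℝ)
      else 0
    ρ 0 0 = 1 / 2 ∧ ρ 1 1 = 1 / 2 ∧
    tauOf ρ = fun p q => g p * (starRingEnd ℂ) (g q) := by
  intro g
  have h10 : ρ 1 0 = (starRingEnd ℂ) (ρ 0 1) := (hρ.1.apply 1 0).symm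
  have hdet := hρ.det_nonneg
  rw [Matrix.det_fin_two, h10, Complex.mul_conj, Complex.normSq_eq_norm_sq, hcoh] at hdet
  have h0 : (starRingEnd ℂ) (ρ 0 0) = ρ 0 0 := hρ.1.apply 0 0
  obtain ⟨a, ha⟩ := Complex.conj_eq_iff_real.mp h0
  have h11 : ρ 1 1 = ((1 - a : ℝ) : ℂ) := by
    rw [Matrix.trace_fin_two, ha] at htr
    push_cast
    linear_combination htr
  rw [ha, h11] at hdet
  have hd : 0 ≤ a * (1 - a) - (1 / 2) ^ 2 := by exact_mod_cast hdet
  have haa : a = 1 / 2 := by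
    have : (a - 1 / 2) ^ 2 = 0 := le_antisymm (by nlinarith) (sq_nonneg _)
    have := pow_eq_zero_iff (two_ne_zero) |>.mp this
    linarith
  have e0 : ρ 0 0 = 1 / 2 := by rw [ha, haa]; push_cast; rfl
  have e1 : ρ 1 1 = 1 / 2 := by rw [h11, haa]; push_cast; norm_num
  have hs : ((Real.sqrt 2 : ℝ) : ℂ) ^ 2 = 2 := by
    rw [← Complex.ofReal_pow, Real.sq_sqrt (by norm_num)]; norm_num
  have hs0 : ((Real.sqrt 2 : ℝ) : ℂ) ≠ 0 := by
    intro h; rw [h] at hs; norm_num at hs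
  have hn : ρ 0 1 * (starRingEnd ℂ) (ρ 0 1) = 1 / 4 := by
    rw [Complex.mul_conj, Complex.normSq_eq_norm_sq, hcoh]; norm_num
  have h2 : (starRingEnd ℂ) 2 = 2 := Complex.conj_ofNat 2
  refine ⟨e0, e1, ?_⟩
  funext p q
  obtain ⟨i, j, k⟩ := p
  obtain ⟨l, m, n⟩ := q
  fin_cases i <;> fin_cases j <;> fin_cases k <;> fin_cases l <;> fin_cases m <;>
    fin_cases n <;> simp [tauOf, g, h2]
  · rw [e0]; field_simp; rw [hs]
  · field_simp; rw [hs]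
  · rw [h10]; field_simp; rw [hs]
  · rw [e1]; field_simp; rw [hs]; linear_combination (-8 : ℂ) * hn
end

section
/- Let W ∈ ℂ⁸, indexed by Fin 2 × Fin 2 × Fin 2, be the unit vector W = (e_{(0,0,1)} + e_{(0,1,0)} + e_{(1,0,0)})/√3. Then for every 2×2 complex density matrix ρ, every bijection π of the index set Fin 2 × Fin 2 × Fin 2, and every phase function θ from this index set to ℝ, the incoherent unitary U defined by U e_m = exp(i θ(m)) e_{π(m)} satisfies U (ρ ⊗ |0⟩⟨0| ⊗ |0⟩⟨0|) U† ≠ |W⟩⟨W|. (Indeed the sum of absolute values of off-diagonal entries of U (ρ ⊗ |0⟩⟨0| ⊗ |0⟩⟨0|) U† equals 2|ρ_{01}| ≤ 1, while that of |W⟩⟨W| equals 2.) -/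
open Matrix Kronecker ComplexOrder

/-- The 2×2 matrix `|0⟩⟨0|`. -/
noncomputable def ket00 : Matrix (Fin 2) (Fin 2) ℂ :=
  fun i j => if i = 0 ∧ j = 0 then 1 else 0

/-- The three-qubit W state vector `(e_{001} + e_{010} + e_{100})/√3`. -/
noncomputable def wVec : Fin 2 × Fin 2 × Fin 2 → ℂ := fun p =>
  if p = (0, 0, 1) ∨ p = (0, 1, 0) ∨ p = (1, 0, 0) then (1 / Real.sqrt 3 : ℝ) else 0

theorem stmt12 (ρ : Matrix (Fin 2) (Fin 2) ℂ) (hρ : ρ.PosSemidef) (htr : ρ.trace = 1)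
    (π : Equiv.Perm (Fin 2 × Fin 2 × Fin 2)) (θ : Fin 2 × Fin 2 × Fin 2 → ℝ) :
    let U : Matrix (Fin 2 × Fin 2 × Fin 2) (Fin 2 × Fin 2 × Fin 2) ℂ :=
      fun p q => if p = π q then Complex.exp (Complex.I * (θ q : ℝ)) else 0
    U * (ρ ⊗ₖ (ket00 ⊗ₖ ket00)) * Uᴴ ≠ fun p q => wVec p * (starRingEnd ℂ) (wVec q) := by
  intro U h
  have hU : ∀ p q, q ≠ π.symm p → U p q = 0 := by
    intro p q hq
    have : p ≠ π q := fun e => hq (by rw [e, Equiv.symm_apply_apply])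
    simp [U, this]
  have key : ∀ p, wVec p ≠ 0 → (π.symm p).2 = (0, 0) := by
    intro p hp
    by_contra hne
    have h1 := congrFun (congrFun h p) p
    rw [Matrix.mul_apply, Finset.sum_eq_single (π.symm p), Matrix.mul_apply,
      Finset.sum_eq_single (π.symm p)] at h1
    · have h0 : (ρ ⊗ₖ (ket00 ⊗ₖ ket00)) (π.symm p) (π.symm p) = 0 := by
        have h2 : ¬ ((π.symm p).2.1 = 0 ∧ (π.symm p).2.2 = 0) :=
          fun e => hne (Prod.ext e.1 e.2)
        simp only [Matrix.kroneckerMap_apply, ket00]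
        by_cases h3 : (π.symm p).2.1 = 0
        · have h4 : (π.symm p).2.2 ≠ 0 := fun e => h2 ⟨h3, e⟩
          simp [h4]
        · simp [h3]
      rw [h0] at h1
      have h5 : wVec p * (starRingEnd ℂ) (wVec p) ≠ 0 :=
        mul_ne_zero hp ((map_ne_zero _).2 hp)
      exact h5 (by rw [← h1]; simp)
    · intro b _ hb
      rw [hU p b hb, zero_mul]
    · simp
    · intro b _ hb
      rw [Matrix.conjTranspose_apply, hU p b hb, star_zero, mul_zero]
    · simp
  have ha := key (0, 0, 1) (by simp [wVec])
  have hb := key (0, 1, 0) (by simp [wVec])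
  have hc := key (1, 0, 0) (by simp [wVec])
  have hab : (π.symm (0, 0, 1)).1 ≠ (π.symm (0, 1, 0)).1 := fun e =>
    absurd (π.symm.injective (Prod.ext e (ha.trans hb.symm))) (by decide)
  have hac : (π.symm (0, 0, 1)).1 ≠ (π.symm (1, 0, 0)).1 := fun e =>
    absurd (π.symm.injective (Prod.ext e (ha.trans hc.symm))) (by decide)
  have hbc : (π.symm (0, 1, 0)).1 ≠ (π.symm (1, 0, 0)).1 := fun e =>
    absurd (π.symm.injective (Prod.ext e (hb.trans hc.symm))) (by decide)
  omega
end

section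
/- Let ρ be a 2×2 complex density matrix and let τ(ρ) be the 8×8 matrix, indexed by Fin 2 × Fin 2 × Fin 2, whose ((i,i,i),(j,j,j)) entry is ρ_{ij} and all other entries 0. Let m be the 3×9 real matrix with rows indexed by j ∈ {1,2,3} and columns indexed by pairs (i,k) ∈ {1,2,3}², with entries m_{j,(i,k)} = Re Tr(τ(ρ)·(σ_i ⊗ σ_j ⊗ σ_k)). Then m·mᵗ = diag(8|ρ_{01}|², 8|ρ_{01}|², (ρ_{00} − ρ_{11})²); in particular, when 2√2|ρ_{01}| ≥ |ρ_{00} − ρ_{11}|, the largest singular value of m equals 2√2|ρ_{01}| = √2·C_{l₁}(ρ). -/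
open Matrix Kronecker ComplexOrder

/-- The 3×9 correlation matrix `m_{j,(i,k)} = Re Tr(τ(ρ)(σ_i ⊗ σ_j ⊗ σ_k))`. -/
noncomputable def corrM (ρ : Matrix (Fin 2) (Fin 2) ℂ) :
    Matrix (Fin 3) (Fin 3 × Fin 3) ℝ :=
  fun j ik => (Matrix.trace (tauOf ρ * (pauli ik.1 ⊗ₖ (pauli j ⊗ₖ pauli ik.2)))).re

theorem corrM_apply_aux (ρ : Matrix (Fin 2) (Fin 2) ℂ) (j i k : Fin 3) :
    corrM ρ j (i, k) = (∑ a, ∑ b, ρ a b * (pauli i b a * (pauli j b a * pauli k b a))).re := by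
  simp [corrM, tauOf, Matrix.trace, Matrix.mul_apply, Fintype.sum_prod_type, Fin.sum_univ_two,
    Matrix.kroneckerMap_apply]

theorem stmt14 (ρ : Matrix (Fin 2) (Fin 2) ℂ) (hρ : ρ.PosSemidef) (htr : ρ.trace = 1) :
    corrM ρ * (corrM ρ)ᵀ =
      Matrix.diagonal ![8 * ‖ρ 0 1‖ ^ 2, 8 * ‖ρ 0 1‖ ^ 2,
        ((ρ 0 0).re - (ρ 1 1).re) ^ 2] ∧
    (|(ρ 0 0).re - (ρ 1 1).re| ≤ 2 * Real.sqrt 2 * ‖ρ 0 1‖ →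
      Real.sqrt (max (8 * ‖ρ 0 1‖ ^ 2) (((ρ 0 0).re - (ρ 1 1).re) ^ 2)) =
        2 * Real.sqrt 2 * ‖ρ 0 1‖ ∧
      Real.sqrt (max (8 * ‖ρ 0 1‖ ^ 2) (((ρ 0 0).re - (ρ 1 1).re) ^ 2)) =
        Real.sqrt 2 * (2 * ‖ρ 0 1‖)) := by
  have h10 : ρ 1 0 = star (ρ 0 1) := (hρ.1.apply 1 0).symm
  have hn : ‖ρ 0 1‖ ^ 2 = (ρ 0 1).re ^ 2 + (ρ 0 1).im ^ 2 := by
    rw [← Complex.normSq_eq_norm_sq, Complex.normSq_apply]; ring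
  refine ⟨?_, ?_⟩
  · ext j j'
    rw [Matrix.mul_apply, Fintype.sum_prod_type]
    simp only [Matrix.transpose_apply, corrM_apply_aux, hn, Fin.sum_univ_three, Fin.sum_univ_two,
      h10]
    fin_cases j <;> fin_cases j' <;> simp [pauli] <;> ring
  · intro h
    have h2 : Real.sqrt 2 ^ 2 = 2 := Real.sq_sqrt (by norm_num)
    have h3 : ((ρ 0 0).re - (ρ 1 1).re) ^ 2 ≤ 8 * ‖ρ 0 1‖ ^ 2 := by
      have := pow_le_pow_left₀ (abs_nonneg _) h 2
      rw [sq_abs, mul_pow, mul_pow, h2] at this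
      linarith
    have h4 : Real.sqrt (max (8 * ‖ρ 0 1‖ ^ 2) (((ρ 0 0).re - (ρ 1 1).re) ^ 2)) =
        2 * Real.sqrt 2 * ‖ρ 0 1‖ := by
      rw [max_eq_left h3, Real.sqrt_eq_iff_mul_self_eq (by positivity) (by positivity)]
      linear_combination (-4 * ‖ρ 0 1‖ ^ 2) * h2
    exact ⟨h4, by rw [h4]; ring⟩
end

section
/- Let ρ be a 2×2 complex density matrix with |ρ_{01}| > 1/(2√2) (equivalently C_{l₁}(ρ) > 1/√2), and let τ(ρ) be the 8×8 matrix, indexed by Fin 2 × Fin 2 × Fin 2, whose ((i,i,i),(j,j,j)) entry is ρ_{ij} and all other entries 0. Then there exist unit vectors a, a', b, b', c, c' ∈ ℝ³ such that |Tr(τ(ρ)·S)| > 4, where S is the Svetlichny operator S = (a·σ)⊗[(b·σ)⊗(c·σ) + (b·σ)⊗(c'·σ) + (b'·σ)⊗(c·σ) − (b'·σ)⊗(c'·σ)] + (a'·σ)⊗[(b·σ)⊗(c·σ) − (b·σ)⊗(c'·σ) − (b'·σ)⊗(c·σ) − (b'·σ)⊗(c'·σ)]. -/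
open Matrix Kronecker ComplexOrder

/-- The Svetlichny operator built from unit vectors `a, a', b, b', c, c' ∈ ℝ³`. -/
noncomputable def svetlichnyOp (a a' b b' c c' : Fin 3 → ℝ) :
    Matrix (Fin 2 × Fin 2 × Fin 2) (Fin 2 × Fin 2 × Fin 2) ℂ :=
  dotPauli a ⊗ₖ (dotPauli b ⊗ₖ dotPauli c + dotPauli b ⊗ₖ dotPauli c' +
      dotPauli b' ⊗ₖ dotPauli c - dotPauli b' ⊗ₖ dotPauli c') +
    dotPauli a' ⊗ₖ (dotPauli b ⊗ₖ dotPauli c - dotPauli b ⊗ₖ dotPauli c' -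
      dotPauli b' ⊗ₖ dotPauli c - dotPauli b' ⊗ₖ dotPauli c')

theorem trace_aux (ρ : Matrix (Fin 2) (Fin 2) ℂ) (x y p q : ℝ)
    (h01 : ρ 0 1 = x + y * Complex.I) (h10 : ρ 1 0 = x - y * Complex.I) :
    Matrix.trace (tauOf ρ * svetlichnyOp ![p, q, 0] ![-q, p, 0] ![1, 0, 0] ![0, 1, 0]
      ![1, 0, 0] ![0, 1, 0]) = ((8 * ((x - y) * p - (x + y) * q) : ℝ) : ℂ) := by
  simp [Matrix.trace, Matrix.mul_apply, Fintype.sum_prod_type, Fin.sum_univ_two, tauOf,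
    svetlichnyOp, dotPauli, pauli, h01, h10]
  ring_nf
  simp only [Complex.I_sq, show Complex.I ^ 3 = -Complex.I by rw [pow_succ, Complex.I_sq]; ring,
    show Complex.I ^ 4 = 1 from Complex.I_pow_four]
  ring

theorem stmt15 (ρ : Matrix (Fin 2) (Fin 2) ℂ) (hρ : ρ.PosSemidef) (htr : ρ.trace = 1)
    (hcoh : 1 / (2 * Real.sqrt 2) < ‖ρ 0 1‖) :
    ∃ a a' b b' c c' : Fin 3 → ℝ,
      a 0 ^ 2 + a 1 ^ 2 + a 2 ^ 2 = 1 ∧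
      a' 0 ^ 2 + a' 1 ^ 2 + a' 2 ^ 2 = 1 ∧
      b 0 ^ 2 + b 1 ^ 2 + b 2 ^ 2 = 1 ∧
      b' 0 ^ 2 + b' 1 ^ 2 + b' 2 ^ 2 = 1 ∧
      c 0 ^ 2 + c 1 ^ 2 + c 2 ^ 2 = 1 ∧
      c' 0 ^ 2 + c' 1 ^ 2 + c' 2 ^ 2 = 1 ∧
      4 < ‖Matrix.trace (tauOf ρ * svetlichnyOp a a' b b' c c')‖ := by
  have h10 : ρ 1 0 = star (ρ 0 1) := (hρ.isHermitian.apply 1 0).symm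
  obtain ⟨x, hx⟩ : ∃ x, x = (ρ 0 1).re := ⟨_, rfl⟩
  obtain ⟨y, hy⟩ : ∃ y, y = (ρ 0 1).im := ⟨_, rfl⟩
  obtain ⟨r, hr⟩ : ∃ r, r = ‖ρ 0 1‖ := ⟨_, rfl⟩
  have hs : 0 < Real.sqrt 2 := by positivity
  have hs2 : Real.sqrt 2 ^ 2 = 2 := Real.sq_sqrt (by norm_num)
  rw [← hr] at hcoh
  have hrpos : 0 < r := lt_trans (by positivity) hcoh
  have hr2 : r ^ 2 = x ^ 2 + y ^ 2 := by
    rw [hr, hx, hy, Complex.sq_norm, Complex.normSq_apply]; ring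
  have e01 : ρ 0 1 = x + y * Complex.I := by rw [hx, hy, Complex.re_add_im]
  have e10 : ρ 1 0 = x - y * Complex.I := by
    rw [h10, e01]; simp [sub_eq_add_neg]
  have hu : ((x - y) / (r * Real.sqrt 2)) ^ 2 + (-(x + y) / (r * Real.sqrt 2)) ^ 2 = 1 := by
    rw [div_pow, div_pow, ← add_div, mul_pow, hs2, hr2, div_eq_one_iff_eq (by rw [← hr2]; positivity)]
    ring
  refine ⟨_, _, _, _, _, _, ?_, ?_, ?_, ?_, ?_, ?_, lt_of_lt_of_eq ?_ (congrArg norm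
    (trace_aux ρ x y ((x - y) / (r * Real.sqrt 2)) (-(x + y) / (r * Real.sqrt 2)) e01 e10)).symm⟩
  · simpa using hu
  · simp only [cons_val_zero, cons_val_one, cons_val]
    linarith [hu]
  · simp
  · simp
  · simp
  · simp
  · have key : 8 * ((x - y) * ((x - y) / (r * Real.sqrt 2)) -
        (x + y) * (-(x + y) / (r * Real.sqrt 2))) = 8 * Real.sqrt 2 * r := by
      field_simp
      rw [hs2, hr2]; ring
    rw [key, Complex.norm_real, Real.norm_eq_abs]
    refine lt_of_lt_of_le ?_ (le_abs_self _)
    rw [div_lt_iff₀ (by positivity)] at hcoh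
    linarith
end

section
/- Let ρ be a 2×2 complex density matrix, write a = Re ρ_{01}, and let τ(ρ) be the 8×8 matrix, indexed by Fin 2 × Fin 2 × Fin 2, whose ((i,i,i),(j,j,j)) entry is ρ_{ij} and all other entries 0. With the observables X₀ = Y₀ = σ₃, X₁ = Y₁ = σ₁, Z₀ = (σ₃ − σ₁)/√2, Z₁ = (σ₃ + σ₁)/√2, one has Tr(τ(ρ)·(X₀⊗Y₀⊗I)) + Tr(τ(ρ)·(X₀⊗I⊗Z₀)) + Tr(τ(ρ)·(I⊗Y₀⊗Z₁)) − Tr(τ(ρ)·(X₁⊗Y₁⊗Z₀)) + Tr(τ(ρ)·(X₁⊗Y₁⊗Z₁)) = 1 + √2 + 2√2·a; and with the same X's and Y's but Z₀ = (σ₃ + σ₁)/√2, Z₁ = (σ₃ − σ₁)/√2, the same expression equals 1 + √2 − 2√2·a. -/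
open Matrix Kronecker ComplexOrder

theorem trace_tau_aux (ρ A B C : Matrix (Fin 2) (Fin 2) ℂ) :
    Matrix.trace (tauOf ρ * (A ⊗ₖ (B ⊗ₖ C))) =
      ρ 0 0 * (A 0 0 * (B 0 0 * C 0 0)) + ρ 0 1 * (A 1 0 * (B 1 0 * C 1 0)) +
      (ρ 1 0 * (A 0 1 * (B 0 1 * C 0 1)) + ρ 1 1 * (A 1 1 * (B 1 1 * C 1 1))) := by
  simp [Matrix.trace, Matrix.mul_apply, Fintype.sum_prod_type, tauOf, Fin.sum_univ_two]

theorem stmt16 (ρ : Matrix (Fin 2) (Fin 2) ℂ) (hρ : ρ.PosSemidef) (htr : ρ.trace = 1) :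
    let a : ℝ := (ρ 0 1).re
    let X₀ := pauli 2
    let X₁ := pauli 0
    let Y₀ := pauli 2
    let Y₁ := pauli 0
    let I₂ : Matrix (Fin 2) (Fin 2) ℂ := 1
    let Z₀ := ((Real.sqrt 2 : ℝ)⁻¹ : ℂ) • (pauli 2 - pauli 0)
    let Z₁ := ((Real.sqrt 2 : ℝ)⁻¹ : ℂ) • (pauli 2 + pauli 0)
    (Matrix.trace (tauOf ρ * (X₀ ⊗ₖ (Y₀ ⊗ₖ I₂))) +
      Matrix.trace (tauOf ρ * (X₀ ⊗ₖ (I₂ ⊗ₖ Z₀))) +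
      Matrix.trace (tauOf ρ * (I₂ ⊗ₖ (Y₀ ⊗ₖ Z₁))) -
      Matrix.trace (tauOf ρ * (X₁ ⊗ₖ (Y₁ ⊗ₖ Z₀))) +
      Matrix.trace (tauOf ρ * (X₁ ⊗ₖ (Y₁ ⊗ₖ Z₁))) =
        ((1 + Real.sqrt 2 + 2 * Real.sqrt 2 * a : ℝ) : ℂ)) ∧
    (Matrix.trace (tauOf ρ * (X₀ ⊗ₖ (Y₀ ⊗ₖ I₂))) +
      Matrix.trace (tauOf ρ * (X₀ ⊗ₖ (I₂ ⊗ₖ Z₁))) +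
      Matrix.trace (tauOf ρ * (I₂ ⊗ₖ (Y₀ ⊗ₖ Z₀))) -
      Matrix.trace (tauOf ρ * (X₁ ⊗ₖ (Y₁ ⊗ₖ Z₁))) +
      Matrix.trace (tauOf ρ * (X₁ ⊗ₖ (Y₁ ⊗ₖ Z₀))) =
        ((1 + Real.sqrt 2 - 2 * Real.sqrt 2 * a : ℝ) : ℂ)) := by
  have h10 : ρ 1 0 = star (ρ 0 1) := (hρ.1.apply 1 0).symm
  have h01 : ρ 0 1 + ρ 1 0 = 2 * ((ρ 0 1).re : ℂ) := by
    rw [h10]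
    apply Complex.ext <;> simp
    ring
  have ht : ρ 0 0 + ρ 1 1 = 1 := by
    simpa [Matrix.trace, Fin.sum_univ_two] using htr
  have hs : ((Real.sqrt 2 : ℝ) : ℂ) * ((Real.sqrt 2 : ℝ) : ℂ) = 2 := by
    rw [← Complex.ofReal_mul, Real.mul_self_sqrt (by norm_num)]; norm_num
  have hne : ((Real.sqrt 2 : ℝ) : ℂ) ≠ 0 := by
    intro h
    rw [h] at hs
    norm_num at hs
  have hinv : ((Real.sqrt 2 : ℝ) : ℂ)⁻¹ = ((Real.sqrt 2 : ℝ) : ℂ) / 2 := by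
    field_simp
    rw [pow_two, hs]
  intro a X₀ X₁ Y₀ Y₁ I₂ Z₀ Z₁
  simp only [trace_tau_aux]
  simp [a, X₀, X₁, Y₀, Y₁, I₂, Z₀, Z₁, pauli, hinv]
  generalize ((Real.sqrt 2 : ℝ) : ℂ) = s at *
  constructor
  · linear_combination (1 + s) * ht + s * h01
  · linear_combination (1 + s) * ht - s * h01
end

section
/- Let ρ be a 2×2 complex density matrix with |Re ρ_{01}| > (√2 − 1)/2, and let τ(ρ) be the 8×8 matrix, indexed by Fin 2 × Fin 2 × Fin 2, whose ((i,i,i),(j,j,j)) entry is ρ_{ij} and all other entries 0. Then there exist Hermitian 2×2 matrices X₀, X₁, Y₀, Y₁, Z₀, Z₁ with Xᵢ² = Yᵢ² = Zᵢ² = I such that Tr(τ(ρ)·(X₀⊗Y₀⊗I)) + Tr(τ(ρ)·(X₀⊗I⊗Z₀)) + Tr(τ(ρ)·(I⊗Y₀⊗Z₁)) − Tr(τ(ρ)·(X₁⊗Y₁⊗Z₀)) + Tr(τ(ρ)·(X₁⊗Y₁⊗Z₁)) > 3, i.e. τ(ρ) violates the 𝒯 inequality. -/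
open Matrix Kronecker ComplexOrder

theorem tau_trace (ρ A B C : Matrix (Fin 2) (Fin 2) ℂ) :
    Matrix.trace (tauOf ρ * (A ⊗ₖ (B ⊗ₖ C))) =
      ρ 0 0 * (A 0 0 * B 0 0 * C 0 0) + ρ 0 1 * (A 1 0 * B 1 0 * C 1 0) +
      ρ 1 0 * (A 0 1 * B 0 1 * C 0 1) + ρ 1 1 * (A 1 1 * B 1 1 * C 1 1) := by
  simp [Matrix.trace, Matrix.mul_apply, tauOf, Fintype.sum_prod_type, Fin.sum_univ_two]
  ring

theorem stmt17 (ρ : Matrix (Fin 2) (Fin 2) ℂ) (hρ : ρ.PosSemidef) (htr : ρ.trace = 1)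
    (hcoh : (Real.sqrt 2 - 1) / 2 < |(ρ 0 1).re|) :
    ∃ X₀ X₁ Y₀ Y₁ Z₀ Z₁ : Matrix (Fin 2) (Fin 2) ℂ,
      X₀.IsHermitian ∧ X₁.IsHermitian ∧ Y₀.IsHermitian ∧ Y₁.IsHermitian ∧
      Z₀.IsHermitian ∧ Z₁.IsHermitian ∧
      X₀ * X₀ = 1 ∧ X₁ * X₁ = 1 ∧ Y₀ * Y₀ = 1 ∧ Y₁ * Y₁ = 1 ∧
      Z₀ * Z₀ = 1 ∧ Z₁ * Z₁ = 1 ∧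
      3 < (Matrix.trace (tauOf ρ * (X₀ ⊗ₖ (Y₀ ⊗ₖ (1 : Matrix (Fin 2) (Fin 2) ℂ)))) +
        Matrix.trace (tauOf ρ * (X₀ ⊗ₖ ((1 : Matrix (Fin 2) (Fin 2) ℂ) ⊗ₖ Z₀))) +
        Matrix.trace (tauOf ρ * ((1 : Matrix (Fin 2) (Fin 2) ℂ) ⊗ₖ (Y₀ ⊗ₖ Z₁))) -
        Matrix.trace (tauOf ρ * (X₁ ⊗ₖ (Y₁ ⊗ₖ Z₀))) +
        Matrix.trace (tauOf ρ * (X₁ ⊗ₖ (Y₁ ⊗ₖ Z₁)))).re := by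
  obtain ⟨s, hs, hsr⟩ : ∃ s : ℝ, s * s = 1 ∧ s * (ρ 0 1).re = |(ρ 0 1).re| := by
    rcases abs_cases (ρ 0 1).re with ⟨h, _⟩ | ⟨h, _⟩
    · exact ⟨1, by norm_num, by rw [h]; ring⟩
    · exact ⟨-1, by norm_num, by rw [h]; ring⟩
  obtain ⟨t, ht⟩ : ∃ t : ℝ, t = Real.sqrt 2 / 2 := ⟨_, rfl⟩
  have h2 : Real.sqrt 2 * Real.sqrt 2 = 2 := Real.mul_self_sqrt (by norm_num)
  have htt : t * t + t * t = 1 := by rw [ht]; linarith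
  have hsC : (s : ℂ) * s = 1 := by exact_mod_cast hs
  have httC : (t : ℂ) * t + t * t = 1 := by exact_mod_cast htt
  have h10 : (ρ 1 0).re = (ρ 0 1).re := by
    rw [← hρ.1.apply 1 0]; simp
  have h11 : (ρ 0 0).re + (ρ 1 1).re = 1 := by
    have := congrArg Complex.re htr
    simpa [Matrix.trace, Fin.sum_univ_two] using this
  refine ⟨!![1, 0; 0, -1], !![0, (s : ℂ); (s : ℂ), 0], !![1, 0; 0, -1], !![0, 1; 1, 0],
    !![(t : ℂ), -t; -t, -t], !![(t : ℂ), t; t, -t], ?_, ?_, ?_, ?_, ?_, ?_, ?_, ?_, ?_, ?_, ?_, ?_, ?_⟩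
  iterate 6 (ext i j; fin_cases i <;> fin_cases j <;> simp)
  iterate 6 (ext i j; fin_cases i <;> fin_cases j <;> simp [Matrix.mul_apply, hsC, httC])
  simp only [tau_trace]
  simp
  have ht0 : 0 < Real.sqrt 2 := by positivity
  have key := mul_lt_mul_of_pos_left hcoh ht0
  rw [← hsr] at key
  rw [h10, ht]
  have e : (ρ 1 1).re = 1 - (ρ 0 0).re := by linarith
  rw [e]
  nlinarith [key, h2]
end
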